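/- (Local existence of the augmentation: compatibility of the augmentation system.) Let U ⊆ ℍ° be open and let Φ : U → M₂(ℝ) be smooth with Φ(ρ,z) symmetric positive definite, det Φ ≡ 1, satisfying the axisymmetric harmonic-map equation on U. Set 𝒰 := I + ρΦ⁻¹∂_ρΦ and 𝒱 := ρΦ⁻¹∂_zΦ. Then ∂_z( −(2ρ)⁻¹ + (8ρ)⁻¹ Tr(𝒰² − 𝒱²) ) = ∂_ρ( (4ρ)⁻¹ Tr(𝒰𝒱) ) on U. In particular, if U is simply connected then there exists a smooth function ν on U, unique up to an additive constant, with ∂_zν = (4ρ)⁻¹Tr(𝒰𝒱) and ∂_ρν = −(2ρ)⁻¹ + (8ρ)⁻¹Tr(𝒰² − 𝒱²). -/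

import Mathlib

noncomputable section

open Real Topology Filter Matrix MeasureTheory

abbrev Mat2 : Type := Matrix (Fin 2) (Fin 2) ℝ

/-- Partial derivative in the first variable (`ρ`). -/
def pd1 (f : ℝ × ℝ → ℝ) (p : ℝ × ℝ) : ℝ := deriv (fun t => f (t, p.2)) p.1

/-- Partial derivative in the second variable (`z`). -/
def pd2 (f : ℝ × ℝ → ℝ) (p : ℝ × ℝ) : ℝ := deriv (fun t => f (p.1, t)) p.2

/-- Entrywise partial derivative (in `ρ`) of a matrix-valued function. -/
def mpd1 (F : ℝ × ℝ → Mat2) (p : ℝ × ℝ) : Mat2 :=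
  Matrix.of fun i j => pd1 (fun q => F q i j) p

/-- Entrywise partial derivative (in `z`) of a matrix-valued function. -/
def mpd2 (F : ℝ × ℝ → Mat2) (p : ℝ × ℝ) : Mat2 :=
  Matrix.of fun i j => pd2 (fun q => F q i j) p

/-- The open right half plane `ℍ° = {(ρ, z) : ρ > 0}`. -/
def Hplane : Set (ℝ × ℝ) := {p | 0 < p.1}

/-- A matrix-valued map is smooth on a set if each entry is `C^∞` there. -/
def SmoothMatOn (F : ℝ × ℝ → Mat2) (U : Set (ℝ × ℝ)) : Prop :=
  ∀ i j, ContDiffOn ℝ (⊤ : ℕ∞) (fun q => F q i j) U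

/-- The axisymmetric harmonic-map equation
`∂_ρ(ρ Φ⁻¹ ∂_ρΦ) + ∂_z(ρ Φ⁻¹ ∂_zΦ) = 0` on `U`. -/
def axiHarmonicOn (Φ : ℝ × ℝ → Mat2) (U : Set (ℝ × ℝ)) : Prop :=
  ∀ p ∈ U,
    mpd1 (fun q => q.1 • ((Φ q)⁻¹ * mpd1 Φ q)) p +
      mpd2 (fun q => q.1 • ((Φ q)⁻¹ * mpd2 Φ q)) p = 0

/-- `𝒰 := I + ρ Φ⁻¹ ∂_ρΦ`. -/
def Umat (Φ : ℝ × ℝ → Mat2) (p : ℝ × ℝ) : Mat2 := 1 + p.1 • ((Φ p)⁻¹ * mpd1 Φ p)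

/-- `𝒱 := ρ Φ⁻¹ ∂_zΦ`. -/
def Vmat (Φ : ℝ × ℝ → Mat2) (p : ℝ × ℝ) : Mat2 := p.1 • ((Φ p)⁻¹ * mpd2 Φ p)

/-- `ν` is an augmentation for `Φ` on `U`. -/
def IsAugmentationOn (Φ : ℝ × ℝ → Mat2) (ν : ℝ × ℝ → ℝ) (U : Set (ℝ × ℝ)) : Prop :=
  ContDiffOn ℝ (⊤ : ℕ∞) ν U ∧ ∀ p ∈ U,
    pd2 ν p = (4 * p.1)⁻¹ * (Umat Φ p * Vmat Φ p).trace ∧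
    pd1 ν p = -(2 * p.1)⁻¹ +
      (8 * p.1)⁻¹ * (Umat Φ p * Umat Φ p - Vmat Φ p * Vmat Φ p).trace

/-- `r = √(ρ² + z²)`. -/
def rr (p : ℝ × ℝ) : ℝ := Real.sqrt (p.1 ^ 2 + p.2 ^ 2)

/-- The action `P.Φ := (P⁻¹)ᵀ Φ P⁻¹` of `GL(2,ℝ)` on matrices. -/
def matAct (P M : Mat2) : Mat2 := (P⁻¹)ᵀ * M * P⁻¹

/-- The action of `GL(2,ℝ)` on matrix-valued maps. -/
def mapAct (P : Mat2) (Φ : ℝ × ℝ → Mat2) : ℝ × ℝ → Mat2 := fun q => matAct P (Φ q)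

/-- Local functions whose differences are locally constant glue, up to local constants, to a global
function on a simply connected space. -/
theorem exists_sub_locallyConstant_of_simplyConnected {X F ι : Type*} [TopologicalSpace X]
    [SimplyConnectedSpace X] [LocallyPathConnectedSpace X] [AddCommGroup F]
    (V : ι → Set X) (hV : ∀ i, IsOpen (V i)) (hcover : ∀ x, ∃ i, x ∈ V i) (f : ι → X → F)
    (hf : ∀ i j, ∀ x ∈ V i ∩ V j, ∀ᶠ y in 𝓝 x, f i y - f j y = f i x - f j x) :
    ∃ g : X → F, ∀ i, ∀ x ∈ V i, ∀ᶠ y in 𝓝 x, g y - f i y = g x - f i x := by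
  let _ : TopologicalSpace F := ⊥
  have : DiscreteTopology F := ⟨rfl⟩
  choose idx hidx using hcover
  let Z : FiberBundleCore ι X F :=
    { baseSet := V
      isOpen_baseSet := hV
      indexAt := idx
      mem_baseSet_at := hidx
      coordChange := fun i j x v => v + (f i x - f j x)
      coordChange_self := fun i x _ v => by simp
      continuousOn_coordChange := fun i j => by
        have hsub : ContinuousOn (fun x => f i x - f j x) (V i ∩ V j) := fun x hx =>
          ContinuousAt.continuousWithinAt <|
            continuousAt_const.congr ((hf i j x hx).mono fun y hy => hy.symm)
        exact continuous_snd.continuousOn.add (hsub.comp continuous_fst.continuousOn fun p hp => hp.1)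
      coordChange_comp := fun i j k x _ v => by abel }
  have hcov : IsCoveringMap Z.proj := FiberBundle.isCoveringMap (F := F) (E := Z.Fiber)
  obtain ⟨x₀⟩ : Nonempty X := inferInstance
  obtain ⟨s, ⟨-, hs⟩, -⟩ := hcov.existsUnique_continuousMap_lifts (ContinuousMap.id X) x₀
    (⟨x₀, (0 : F)⟩ : Z.TotalSpace) rfl
  have hs' : ∀ x, (s x).1 = x := fun x => congrFun hs x
  refine ⟨fun x => (show F from (s x).2) + f (idx x) x, fun i x hx => ?_⟩
  have hcoord : ∀ y, (Z.localTriv i (s y)).2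
      = (show F from (s y).2) + f (idx y) y - f i y := fun y => by
    rw [Z.localTriv_apply]
    simp only [Z, hs' y]
    abel
  have hcont : ContinuousAt (fun y => (Z.localTriv i (s y)).2) x := by
    refine (ContinuousAt.snd ?_)
    refine ContinuousAt.comp (f := s) ?_ s.continuous.continuousAt
    refine (Z.localTriv i).continuousAt ?_
    rw [Z.mem_localTriv_source, hs' x]
    exact hx
  have := hcont.eventually (f := fun y => (Z.localTriv i (s y)).2)
    (p := fun v => v = (Z.localTriv i (s x)).2) (by rw [nhds_discrete]; exact rfl)
  filter_upwards [this] with y hy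
  rw [← hcoord, ← hcoord]
  exact hy

/-- A closed `1`-form on a simply connected open set is exact. -/
theorem IsOpen.exists_hasFDerivAt_of_fderiv_symmetric {E : Type*} [NormedAddCommGroup E]
    [NormedSpace ℝ E] {F : Type*} [NormedAddCommGroup F] [NormedSpace ℝ F] [CompleteSpace F]
    {U : Set E} (hU : IsOpen U) [SimplyConnectedSpace U] {ω : E → E →L[ℝ] F}
    (hω : DifferentiableOn ℝ ω U)
    (hdω : ∀ a ∈ U, ∀ x y, fderiv ℝ ω a x y = fderiv ℝ ω a y x) :
    ∃ f : E → F, ∀ a ∈ U, HasFDerivAt f (ω a) a := by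
  classical
  have hball : ∀ x : U, ∃ r > 0, Metric.ball (x : E) r ⊆ U := fun x =>
    Metric.isOpen_iff.1 hU x x.2
  choose r hr hrU using hball
  have hprim : ∀ x : U, ∃ f : E → F, ∀ a ∈ Metric.ball (x : E) (r x), HasFDerivAt f (ω a) a :=
    fun x => (convex_ball _ _).exists_forall_hasFDerivAt_of_fderiv_symmetric Metric.isOpen_ball
      (hω.mono (hrU x)) fun a ha => hdω a (hrU x ha)
  choose f hf using hprim
  have : LocallyPathConnectedSpace U := hU.locallyPathConnectedSpace
  obtain ⟨g, hg⟩ := exists_sub_locallyConstant_of_simplyConnected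
    (fun x : U => (Subtype.val ⁻¹' Metric.ball (x : E) (r x) : Set U))
    (fun x => Metric.isOpen_ball.preimage continuous_subtype_val)
    (fun x => ⟨x, Metric.mem_ball_self (hr x)⟩) (fun x y => f x y) (by
      intro i j x hx
      obtain ⟨ε, hε, hsub⟩ := Metric.isOpen_iff.1
        (Metric.isOpen_ball.inter Metric.isOpen_ball) (x : E) hx
      have hderiv : ∀ y ∈ Metric.ball (x : E) ε,
          HasFDerivAt (fun y => f i y - f j y) (0 : E →L[ℝ] F) y := fun y hy => 
        ((hf i y (hsub hy).1).fun_sub (hf j y (hsub hy).2)).congr_fderiv (sub_self _)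
      filter_upwards [continuous_subtype_val.continuousAt.preimage_mem_nhds
        (Metric.ball_mem_nhds (x : E) hε)] with y hy
      exact (convex_ball (x : E) ε).is_const_of_fderivWithin_eq_zero (𝕜 := ℝ)
        (fun z hz => (hderiv z hz).differentiableAt.differentiableWithinAt)
        (fun z hz => by
          rw [fderivWithin_of_isOpen Metric.isOpen_ball hz, (hderiv z hz).fderiv])
        hy (Metric.mem_ball_self hε))
  refine ⟨fun x => if h : x ∈ U then g ⟨x, h⟩ else 0, fun a ha => ?_⟩
  have hfa := hf ⟨a, ha⟩ a (Metric.mem_ball_self (hr _))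
  refine (hfa.add_const (g ⟨a, ha⟩ - f ⟨a, ha⟩ a)).congr_of_eventuallyEq ?_
  have hloc := hg ⟨a, ha⟩ ⟨a, ha⟩ (Metric.mem_ball_self (hr _))
  rw [nhds_subtype_eq_comap, eventually_comap] at hloc
  filter_upwards [hloc, hU.mem_nhds ha] with y hy hyU
  rw [dif_pos hyU, ← hy ⟨y, hyU⟩ rfl]
  abel

theorem pd1_eq_fderiv {f : ℝ × ℝ → ℝ} {p : ℝ × ℝ} (hf : DifferentiableAt ℝ f p) :
    pd1 f p = fderiv ℝ f p (1, 0) :=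
  (hf.hasFDerivAt.comp_hasDerivAt_of_eq p.1
    ((hasDerivAt_id p.1).prodMk (hasDerivAt_const p.1 p.2)) rfl).deriv

theorem pd2_eq_fderiv {f : ℝ × ℝ → ℝ} {p : ℝ × ℝ} (hf : DifferentiableAt ℝ f p) :
    pd2 f p = fderiv ℝ f p (0, 1) :=
  (hf.hasFDerivAt.comp_hasDerivAt_of_eq p.2
    ((hasDerivAt_const p.2 p.1).prodMk (hasDerivAt_id p.2)) rfl).deriv

theorem fderiv_eq_pd {f : ℝ × ℝ → ℝ} {p : ℝ × ℝ} (hf : DifferentiableAt ℝ f p) :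
    fderiv ℝ f p = pd1 f p • ContinuousLinearMap.fst ℝ ℝ ℝ +
      pd2 f p • ContinuousLinearMap.snd ℝ ℝ ℝ := by
  rw [pd1_eq_fderiv hf, pd2_eq_fderiv hf]
  ext <;> simp

theorem exists_potential_of_pd_eq {U : Set (ℝ × ℝ)} (hU : IsOpen U) [SimplyConnectedSpace U]
    {P Q : ℝ × ℝ → ℝ} (hP : ContDiffOn ℝ (⊤ : ℕ∞) P U) (hQ : ContDiffOn ℝ (⊤ : ℕ∞) Q U)
    (hPQ : ∀ p ∈ U, pd2 P p = pd1 Q p) :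
    ∃ ν : ℝ × ℝ → ℝ, ContDiffOn ℝ (⊤ : ℕ∞) ν U ∧ ∀ p ∈ U, pd1 ν p = P p ∧ pd2 ν p = Q p := by
  let ω : ℝ × ℝ → ℝ × ℝ →L[ℝ] ℝ := fun p =>
    P p • ContinuousLinearMap.fst ℝ ℝ ℝ + Q p • ContinuousLinearMap.snd ℝ ℝ ℝ
  have hω : ContDiffOn ℝ (⊤ : ℕ∞) ω U :=
    (hP.smul contDiffOn_const).add (hQ.smul contDiffOn_const)
  obtain ⟨ν, hν⟩ := hU.exists_hasFDerivAt_of_fderiv_symmetric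
    (hω.differentiableOn (by simp)) (by
      intro a ha x y
      have hPa := (hP.differentiableOn (by simp)).differentiableAt (hU.mem_nhds ha)
      have hQa := (hQ.differentiableOn (by simp)).differentiableAt (hU.mem_nhds ha)
      have h : fderiv ℝ ω a = _ := ((hPa.hasFDerivAt.smul_const
        (ContinuousLinearMap.fst ℝ ℝ ℝ)).add
          (hQa.hasFDerivAt.smul_const (ContinuousLinearMap.snd ℝ ℝ ℝ))).fderiv
      rw [h, fderiv_eq_pd hPa, fderiv_eq_pd hQa, hPQ a ha]
      simp
      ring)
  refine ⟨ν, ?_, fun p hp => ?_⟩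
  · rw [contDiffOn_infty_iff_fderiv_of_isOpen hU]
    exact ⟨fun p hp => (hν p hp).differentiableAt.differentiableWithinAt,
      hω.congr fun p hp => (hν p hp).fderiv⟩
  · rw [pd1_eq_fderiv (hν p hp).differentiableAt, pd2_eq_fderiv (hν p hp).differentiableAt,
      (hν p hp).fderiv]
    simp [ω]

theorem exists_eq_add_const_of_pd_eq {U : Set (ℝ × ℝ)} (hU : IsOpen U) (hUc : IsPreconnected U)
    {f g : ℝ × ℝ → ℝ} (hf : DifferentiableOn ℝ f U) (hg : DifferentiableOn ℝ g U)
    (h₁ : ∀ p ∈ U, pd1 f p = pd1 g p) (h₂ : ∀ p ∈ U, pd2 f p = pd2 g p) :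
    ∃ c : ℝ, Set.EqOn f (fun p => g p + c) U :=
  hU.exists_eq_add_of_fderiv_eq hUc hf hg fun p hp => by
    rw [fderiv_eq_pd (hf.differentiableAt (hU.mem_nhds hp)),
      fderiv_eq_pd (hg.differentiableAt (hU.mem_nhds hp)), h₁ p hp, h₂ p hp]

/-- Entrywise derivative of a matrix-valued function in the direction `v`. -/
def matDirDeriv (v : ℝ × ℝ) (F : ℝ × ℝ → Mat2) (p : ℝ × ℝ) : Mat2 :=
  Matrix.of fun i j => fderiv ℝ (fun q => F q i j) p v

theorem mpd1_eq_matDirDeriv {F : ℝ × ℝ → Mat2} {p : ℝ × ℝ}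
    (hF : ∀ i j, DifferentiableAt ℝ (fun q => F q i j) p) : mpd1 F p = matDirDeriv (1, 0) F p := by
  ext i j
  exact pd1_eq_fderiv (hF i j)

theorem mpd2_eq_matDirDeriv {F : ℝ × ℝ → Mat2} {p : ℝ × ℝ}
    (hF : ∀ i j, DifferentiableAt ℝ (fun q => F q i j) p) : mpd2 F p = matDirDeriv (0, 1) F p := by
  ext i j
  exact pd2_eq_fderiv (hF i j)

theorem matDirDeriv_congr {v : ℝ × ℝ} {F G : ℝ × ℝ → Mat2} {p : ℝ × ℝ} (h : F =ᶠ[𝓝 p] G) :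
    matDirDeriv v F p = matDirDeriv v G p := by
  ext i j
  have : (fun q => F q i j) =ᶠ[𝓝 p] fun q => G q i j := h.mono fun q hq => by simp only [hq]
  simp only [matDirDeriv, Matrix.of_apply, this.fderiv_eq]

theorem matDirDeriv_mul {v : ℝ × ℝ} {F G : ℝ × ℝ → Mat2} {p : ℝ × ℝ}
    (hF : ∀ i j, DifferentiableAt ℝ (fun q => F q i j) p)
    (hG : ∀ i j, DifferentiableAt ℝ (fun q => G q i j) p) :
    matDirDeriv v (fun q => F q * G q) p =
      matDirDeriv v F p * G p + F p * matDirDeriv v G p := by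
  ext i j
  have h := fun k => (hF i k).hasFDerivAt.mul (hG k j).hasFDerivAt
  have h' : HasFDerivAt (fun q => (F q * G q) i j) _ p :=
    ((h 0).add (h 1)).congr_of_eventuallyEq (.of_forall fun q => by
      simp [Matrix.mul_apply, Fin.sum_univ_two])
  change fderiv ℝ (fun q => (F q * G q) i j) p v = _
  rw [h'.fderiv]
  simp [matDirDeriv, Matrix.mul_apply, Fin.sum_univ_two]
  ring

theorem matDirDeriv_smul {v : ℝ × ℝ} {f : ℝ × ℝ → ℝ} {F : ℝ × ℝ → Mat2} {p : ℝ × ℝ}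
    (hf : DifferentiableAt ℝ f p) (hF : ∀ i j, DifferentiableAt ℝ (fun q => F q i j) p) :
    matDirDeriv v (fun q => f q • F q) p = fderiv ℝ f p v • F p + f p • matDirDeriv v F p := by
  ext i j
  have h : fderiv ℝ (fun q => (f q • F q) i j) p = _ :=
    (hf.hasFDerivAt.mul (hF i j).hasFDerivAt).fderiv
  simp only [matDirDeriv, Matrix.of_apply, h]
  simp
  ring

theorem differentiableAt_trace {F : ℝ × ℝ → Mat2} {p : ℝ × ℝ}
    (hF : ∀ i j, DifferentiableAt ℝ (fun q => F q i j) p) :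
    DifferentiableAt ℝ (fun q => (F q).trace) p ∧
      ∀ v, fderiv ℝ (fun q => (F q).trace) p v = (matDirDeriv v F p).trace := by
  have h := (hF 0 0).hasFDerivAt.add (hF 1 1).hasFDerivAt
  have h' : HasFDerivAt (fun q => (F q).trace) _ p :=
    h.congr_of_eventuallyEq (.of_forall fun q => by simp [Matrix.trace_fin_two])
  exact ⟨h'.differentiableAt, fun v => by
    rw [h'.fderiv]; simp [matDirDeriv, Matrix.trace_fin_two]⟩

theorem matDirDeriv_adjugate {v : ℝ × ℝ} {F : ℝ × ℝ → Mat2} {p : ℝ × ℝ} :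
    matDirDeriv v (fun q => (F q).adjugate) p = (matDirDeriv v F p).adjugate := by
  ext i j
  fin_cases i <;> fin_cases j <;> simp [matDirDeriv, Matrix.adjugate_fin_two]

section SmoothMatOn

variable {F G : ℝ × ℝ → Mat2} {U : Set (ℝ × ℝ)}

theorem SmoothMatOn.differentiableAt (hF : SmoothMatOn F U) (hU : IsOpen U) {p : ℝ × ℝ}
    (hp : p ∈ U) (i j : Fin 2) : DifferentiableAt ℝ (fun q => F q i j) p :=
  ((hF i j).differentiableOn (by simp)).differentiableAt (hU.mem_nhds hp)

theorem SmoothMatOn.congr (hF : SmoothMatOn F U) (h : ∀ p ∈ U, G p = F p) : SmoothMatOn G U :=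
  fun i j => (hF i j).congr fun p hp => by rw [h p hp]

theorem SmoothMatOn.mul (hF : SmoothMatOn F U) (hG : SmoothMatOn G U) :
    SmoothMatOn (fun q => F q * G q) U := fun i j =>
  (((hF i 0).mul (hG 0 j)).add ((hF i 1).mul (hG 1 j))).congr fun p _ => by
    simp [Matrix.mul_apply, Fin.sum_univ_two]

theorem SmoothMatOn.trace (hF : SmoothMatOn F U) :
    ContDiffOn ℝ (⊤ : ℕ∞) (fun q => (F q).trace) U :=
  ((hF 0 0).add (hF 1 1)).congr fun p _ => by simp [Matrix.trace_fin_two]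

theorem SmoothMatOn.adjugate (hF : SmoothMatOn F U) :
    SmoothMatOn (fun q => (F q).adjugate) U := by
  intro i j
  fin_cases i <;> fin_cases j <;> simp only [Matrix.adjugate_fin_two]
  exacts [hF 1 1, (hF 0 1).neg, (hF 1 0).neg, hF 0 0]

theorem SmoothMatOn.matDirDeriv (hF : SmoothMatOn F U) (hU : IsOpen U) (v : ℝ × ℝ) :
    SmoothMatOn (matDirDeriv v F) U := fun i j =>
  (((contDiffOn_infty_iff_fderiv_of_isOpen hU).1 (hF i j)).2).clm_apply contDiffOn_const

theorem SmoothMatOn.matDirDeriv_comm (hF : SmoothMatOn F U) (hU : IsOpen U) {p : ℝ × ℝ}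
    (hp : p ∈ U) (v w : ℝ × ℝ) :
    _root_.matDirDeriv v (_root_.matDirDeriv w F) p =
      _root_.matDirDeriv w (_root_.matDirDeriv v F) p := by
  ext i j
  have hd : DifferentiableAt ℝ (fderiv ℝ fun q => F q i j) p :=
    ((((contDiffOn_infty_iff_fderiv_of_isOpen hU).1 (hF i j)).2).differentiableOn
      (by simp)).differentiableAt (hU.mem_nhds hp)
  have happ : ∀ u w : ℝ × ℝ, fderiv ℝ (fun q => fderiv ℝ (fun q => F q i j) q u) p w =
      fderiv ℝ (fderiv ℝ fun q => F q i j) p w u := fun u w => by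
    rw [(hd.hasFDerivAt.clm_apply (hasFDerivAt_const u p)).fderiv]
    simp
  have hsymm : IsSymmSndFDerivAt ℝ (fun q => F q i j) p :=
    ((hF i j).contDiffAt (hU.mem_nhds hp)).isSymmSndFDerivAt (by
      rw [minSmoothness_of_isRCLikeNormedField]; exact WithTop.coe_le_coe.2 le_top)
  simp only [_root_.matDirDeriv, Matrix.of_apply, happ]
  exact hsymm v w

end SmoothMatOn

section MaurerCartan

variable {Φ : ℝ × ℝ → Mat2} {U : Set (ℝ × ℝ)}

/-- The component `Φ⁻¹ ∂_vΦ` of the Maurer–Cartan form, for `Φ` of determinant one. -/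
def mcForm (Φ : ℝ × ℝ → Mat2) (v p : ℝ × ℝ) : Mat2 := (Φ p).adjugate * matDirDeriv v Φ p

theorem inv_eq_adjugate_of_det_eq_one {A : Mat2} (h : A.det = 1) : A⁻¹ = A.adjugate := by
  simp [Matrix.inv_def, h]

theorem SmoothMatOn.mcForm (hΦ : SmoothMatOn Φ U) (hU : IsOpen U) (v : ℝ × ℝ) :
    SmoothMatOn (mcForm Φ v) U :=
  hΦ.adjugate.mul (hΦ.matDirDeriv hU v)

theorem trace_mcForm (hU : IsOpen U) (hΦ : SmoothMatOn Φ U) (hdet : ∀ p ∈ U, (Φ p).det = 1)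
    (v : ℝ × ℝ) {p : ℝ × ℝ} (hp : p ∈ U) : (mcForm Φ v p).trace = 0 := by
  have hd := hΦ.differentiableAt hU hp
  have h : HasFDerivAt (fun q => (Φ q).det) _ p :=
    (((hd 0 0).hasFDerivAt.mul (hd 1 1).hasFDerivAt).sub
      ((hd 0 1).hasFDerivAt.mul (hd 1 0).hasFDerivAt)).congr_of_eventuallyEq
        (.of_forall fun q => by simp [Matrix.det_fin_two])
  have h0 : HasFDerivAt (fun q => (Φ q).det) (0 : ℝ × ℝ →L[ℝ] ℝ) p :=
    (hasFDerivAt_const (1 : ℝ) p).congr_of_eventuallyEq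
      (Filter.eventually_of_mem (hU.mem_nhds hp) hdet)
  have := congrArg (fun L => L v) (h.unique h0)
  simp only [_root_.mcForm, matDirDeriv, Matrix.trace_fin_two, Matrix.adjugate_fin_two,
    Matrix.mul_apply, Fin.sum_univ_two, Matrix.of_apply]
  simp at this ⊢
  linarith

theorem matDirDeriv_mul_adjugate (hU : IsOpen U) (hΦ : SmoothMatOn Φ U)
    (hdet : ∀ p ∈ U, (Φ p).det = 1) (v : ℝ × ℝ) {p : ℝ × ℝ} (hp : p ∈ U) :
    matDirDeriv v Φ p * (Φ p).adjugate = -(Φ p * (matDirDeriv v Φ p).adjugate) := by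
  have h := matDirDeriv_mul (v := v) (hΦ.differentiableAt hU hp)
    (hΦ.adjugate.differentiableAt hU hp)
  have h0 : matDirDeriv v (fun q => Φ q * (Φ q).adjugate) p = 0 := by
    rw [matDirDeriv_congr (G := fun _ => 1) (Filter.eventually_of_mem (hU.mem_nhds hp)
      fun q hq => by simp [Matrix.mul_adjugate, hdet q hq])]
    ext i j
    simp [matDirDeriv]
  rw [h0, matDirDeriv_adjugate] at h
  exact eq_neg_of_add_eq_zero_left h.symm

/-- The Maurer–Cartan (zero curvature) equation. -/
theorem matDirDeriv_mcForm_sub (hU : IsOpen U) (hΦ : SmoothMatOn Φ U)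
    (hdet : ∀ p ∈ U, (Φ p).det = 1) (v w : ℝ × ℝ) {p : ℝ × ℝ} (hp : p ∈ U) :
    matDirDeriv w (mcForm Φ v) p - matDirDeriv v (mcForm Φ w) p =
      mcForm Φ v p * mcForm Φ w p - mcForm Φ w p * mcForm Φ v p := by
  have hprod : ∀ v w, matDirDeriv w (mcForm Φ v) p =
      (matDirDeriv w Φ p).adjugate * matDirDeriv v Φ p +
        (Φ p).adjugate * matDirDeriv w (matDirDeriv v Φ) p := fun v w => by
    rw [← matDirDeriv_adjugate]
    exact matDirDeriv_mul (hΦ.adjugate.differentiableAt hU hp)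
      ((hΦ.matDirDeriv hU v).differentiableAt hU hp)
  have hcomp : ∀ v w, mcForm Φ v p * mcForm Φ w p =
      -((matDirDeriv v Φ p).adjugate * matDirDeriv w Φ p) := fun v w => by
    calc mcForm Φ v p * mcForm Φ w p
        = (Φ p).adjugate * (matDirDeriv v Φ p * (Φ p).adjugate) * matDirDeriv w Φ p := by
          simp only [_root_.mcForm, Matrix.mul_assoc]
      _ = -((Φ p).adjugate * Φ p * ((matDirDeriv v Φ p).adjugate * matDirDeriv w Φ p)) := by
          rw [matDirDeriv_mul_adjugate hU hΦ hdet v hp]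
          simp only [Matrix.mul_neg, Matrix.neg_mul, Matrix.mul_assoc]
      _ = _ := by rw [Matrix.adjugate_mul, hdet p hp, one_smul, Matrix.one_mul]
  rw [hprod, hprod, hcomp, hcomp, hΦ.matDirDeriv_comm hU hp w v]
  abel

theorem inv_mul_mpd1_eq_mcForm (hU : IsOpen U) (hΦ : SmoothMatOn Φ U)
    (hdet : ∀ p ∈ U, (Φ p).det = 1) {p : ℝ × ℝ} (hp : p ∈ U) :
    (Φ p)⁻¹ * mpd1 Φ p = mcForm Φ (1, 0) p := by
  rw [inv_eq_adjugate_of_det_eq_one (hdet p hp),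
    mpd1_eq_matDirDeriv (hΦ.differentiableAt hU hp), _root_.mcForm]

theorem inv_mul_mpd2_eq_mcForm (hU : IsOpen U) (hΦ : SmoothMatOn Φ U)
    (hdet : ∀ p ∈ U, (Φ p).det = 1) {p : ℝ × ℝ} (hp : p ∈ U) :
    (Φ p)⁻¹ * mpd2 Φ p = mcForm Φ (0, 1) p := by
  rw [inv_eq_adjugate_of_det_eq_one (hdet p hp),
    mpd2_eq_matDirDeriv (hΦ.differentiableAt hU hp), _root_.mcForm]

/-- The axisymmetric harmonic-map equation in terms of the Maurer–Cartan form. -/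
theorem axiHarmonicOn.mcForm_eq (hU : IsOpen U) (hΦ : SmoothMatOn Φ U)
    (hdet : ∀ p ∈ U, (Φ p).det = 1) (hharm : axiHarmonicOn Φ U) {p : ℝ × ℝ} (hp : p ∈ U) :
    mcForm Φ (1, 0) p + p.1 • (matDirDeriv (1, 0) (mcForm Φ (1, 0)) p +
      matDirDeriv (0, 1) (mcForm Φ (0, 1)) p) = 0 := by
  have hsmooth : ∀ v, SmoothMatOn (fun q => q.1 • mcForm Φ v q) U := fun v i j =>
    contDiffOn_fst.mul (hΦ.mcForm hU v i j)
  have h₁ : SmoothMatOn (fun q => q.1 • ((Φ q)⁻¹ * mpd1 Φ q)) U :=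
    (hsmooth (1, 0)).congr fun q hq => by rw [inv_mul_mpd1_eq_mcForm hU hΦ hdet hq]
  have h₂ : SmoothMatOn (fun q => q.1 • ((Φ q)⁻¹ * mpd2 Φ q)) U :=
    (hsmooth (0, 1)).congr fun q hq => by rw [inv_mul_mpd2_eq_mcForm hU hΦ hdet hq]
  have h := hharm p hp
  rw [mpd1_eq_matDirDeriv (h₁.differentiableAt hU hp),
    mpd2_eq_matDirDeriv (h₂.differentiableAt hU hp),
    matDirDeriv_congr (G := fun q => q.1 • mcForm Φ (1, 0) q)
      (Filter.eventually_of_mem (hU.mem_nhds hp) fun q hq => by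
        simp only [inv_mul_mpd1_eq_mcForm hU hΦ hdet hq]),
    matDirDeriv_congr (F := fun q => q.1 • ((Φ q)⁻¹ * mpd2 Φ q))
      (G := fun q => q.1 • mcForm Φ (0, 1) q)
      (Filter.eventually_of_mem (hU.mem_nhds hp) fun q hq => by
        simp only [inv_mul_mpd2_eq_mcForm hU hΦ hdet hq]),
    matDirDeriv_smul differentiableAt_fst ((hΦ.mcForm hU _).differentiableAt hU hp),
    matDirDeriv_smul differentiableAt_fst ((hΦ.mcForm hU _).differentiableAt hU hp)] at h
  rw [← h]
  simp [fderiv_fst, smul_add, add_assoc]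

theorem Umat_Vmat_trace_eq (hU : IsOpen U) (hUH : U ⊆ Hplane) (hΦ : SmoothMatOn Φ U)
    (hdet : ∀ p ∈ U, (Φ p).det = 1) {p : ℝ × ℝ} (hp : p ∈ U) :
    (-(2 * p.1)⁻¹ + (8 * p.1)⁻¹ * (Umat Φ p * Umat Φ p - Vmat Φ p * Vmat Φ p).trace =
      p.1 / 8 * ((mcForm Φ (1, 0) p * mcForm Φ (1, 0) p).trace -
        (mcForm Φ (0, 1) p * mcForm Φ (0, 1) p).trace) - (4 * p.1)⁻¹) ∧
    ((4 * p.1)⁻¹ * (Umat Φ p * Vmat Φ p).trace =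
      p.1 / 4 * (mcForm Φ (1, 0) p * mcForm Φ (0, 1) p).trace) := by
  have hρ : p.1 ≠ 0 := (hUH hp).ne'
  have hM := trace_mcForm hU hΦ hdet (1, 0) hp
  have hN := trace_mcForm hU hΦ hdet (0, 1) hp
  rw [Umat, Vmat, inv_mul_mpd1_eq_mcForm hU hΦ hdet hp, inv_mul_mpd2_eq_mcForm hU hΦ hdet hp]
  simp only [Matrix.add_mul, Matrix.mul_add, Matrix.one_mul, Matrix.mul_one, Matrix.smul_mul,
    Matrix.mul_smul, Matrix.trace_add, Matrix.trace_sub, Matrix.trace_smul, hM, hN, smul_eq_mul,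
    Matrix.trace_one, Fintype.card_fin]
  constructor
  · field_simp
    push_cast
    ring
  · field_simp
    ring

end MaurerCartan

theorem pd2_congr {f g : ℝ × ℝ → ℝ} {U : Set (ℝ × ℝ)} (hU : IsOpen U) (h : Set.EqOn f g U)
    {p : ℝ × ℝ} (hp : p ∈ U) : pd2 f p = pd2 g p :=
  Filter.EventuallyEq.deriv_eq <|
    (by fun_prop : ContinuousAt (fun t : ℝ => (p.1, t)) p.2).eventually
      (Filter.eventually_of_mem (hU.mem_nhds hp) h)

theorem pd1_congr {f g : ℝ × ℝ → ℝ} {U : Set (ℝ × ℝ)} (hU : IsOpen U) (h : Set.EqOn f g U)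
    {p : ℝ × ℝ} (hp : p ∈ U) : pd1 f p = pd1 g p :=
  Filter.EventuallyEq.deriv_eq <|
    (by fun_prop : ContinuousAt (fun t : ℝ => (t, p.2)) p.1).eventually
      (Filter.eventually_of_mem (hU.mem_nhds hp) h)

theorem augmentation_compatible {U : Set (ℝ × ℝ)} (hU : IsOpen U)
    {Φ : ℝ × ℝ → Mat2} (hΦ : SmoothMatOn Φ U) (hdet : ∀ p ∈ U, (Φ p).det = 1)
    (hharm : axiHarmonicOn Φ U) {p : ℝ × ℝ} (hp : p ∈ U) :
    pd2 (fun q => q.1 / 8 * ((mcForm Φ (1, 0) q * mcForm Φ (1, 0) q).trace -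
        (mcForm Φ (0, 1) q * mcForm Φ (0, 1) q).trace) - (4 * q.1)⁻¹) p =
      pd1 (fun q => q.1 / 4 * (mcForm Φ (1, 0) q * mcForm Φ (0, 1) q).trace) p := by
  have hM := hΦ.mcForm hU (1, 0)
  have hN := hΦ.mcForm hU (0, 1)
  have hMd := hM.differentiableAt hU hp
  have hNd := hN.differentiableAt hU hp
  obtain ⟨hMM, hMM'⟩ := differentiableAt_trace ((hM.mul hM).differentiableAt hU hp)
  obtain ⟨hNN, hNN'⟩ := differentiableAt_trace ((hN.mul hN).differentiableAt hU hp)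
  obtain ⟨hMN, hMN'⟩ := differentiableAt_trace ((hM.mul hN).differentiableAt hU hp)
  have hL : pd2 (fun q => q.1 / 8 * ((mcForm Φ (1, 0) q * mcForm Φ (1, 0) q).trace -
      (mcForm Φ (0, 1) q * mcForm Φ (0, 1) q).trace) - (4 * q.1)⁻¹) p =
      p.1 / 8 * (pd2 (fun q => (mcForm Φ (1, 0) q * mcForm Φ (1, 0) q).trace) p -
        pd2 (fun q => (mcForm Φ (0, 1) q * mcForm Φ (0, 1) q).trace) p) := by
    have hslice : DifferentiableAt ℝ (fun t : ℝ => ((p.1, t) : ℝ × ℝ)) p.2 := by fun_prop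
    exact ((((hMM.comp (g := fun q => (mcForm Φ (1, 0) q * mcForm Φ (1, 0) q).trace) p.2
      hslice).hasDerivAt.fun_sub (hNN.comp (g := fun q => (mcForm Φ (0, 1) q *
        mcForm Φ (0, 1) q).trace) p.2 hslice).hasDerivAt).const_mul (p.1 / 8)).sub_const (4 * p.1)⁻¹).deriv
  have hR : pd1 (fun q => q.1 / 4 * (mcForm Φ (1, 0) q * mcForm Φ (0, 1) q).trace) p =
      1 / 4 * (mcForm Φ (1, 0) p * mcForm Φ (0, 1) p).trace +
        p.1 / 4 * pd1 (fun q => (mcForm Φ (1, 0) q * mcForm Φ (0, 1) q).trace) p := by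
    have hslice : DifferentiableAt ℝ (fun t : ℝ => ((t, p.2) : ℝ × ℝ)) p.1 := by fun_prop
    exact (((hasDerivAt_id p.1).div_const 4).mul (hMN.comp (g := fun q => (mcForm Φ (1, 0) q *
      mcForm Φ (0, 1) q).trace) p.1 hslice).hasDerivAt).deriv
  rw [hL, hR, pd2_eq_fderiv hMM, pd2_eq_fderiv hNN, pd1_eq_fderiv hMN, hMM', hNN', hMN',
    matDirDeriv_mul hMd hMd, matDirDeriv_mul hNd hNd, matDirDeriv_mul hMd hNd]
  have hcurv := congrArg (fun X => (mcForm Φ (1, 0) p * X).trace)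
    (matDirDeriv_mcForm_sub hU hΦ hdet (1, 0) (0, 1) hp)
  have heq := congrArg (fun X => (X * mcForm Φ (0, 1) p).trace)
    (hharm.mcForm_eq hU hΦ hdet hp)
  simp only [Matrix.add_mul, Matrix.mul_sub, Matrix.trace_add, Matrix.trace_sub,
    Matrix.smul_mul, Matrix.trace_smul, smul_eq_mul, Matrix.zero_mul, Matrix.trace_zero]
    at hcurv heq ⊢
  have hcyc : (mcForm Φ (1, 0) p * (mcForm Φ (0, 1) p * mcForm Φ (1, 0) p)).trace =
      (mcForm Φ (1, 0) p * (mcForm Φ (1, 0) p * mcForm Φ (0, 1) p)).trace := by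
    rw [Matrix.trace_mul_comm, Matrix.mul_assoc, Matrix.trace_mul_comm, Matrix.mul_assoc]
  rw [Matrix.trace_mul_comm (matDirDeriv (0, 1) (mcForm Φ (1, 0)) p),
    Matrix.trace_mul_comm (mcForm Φ (0, 1) p) (matDirDeriv (0, 1) (mcForm Φ (0, 1)) p)]
  linear_combination p.1 / 4 * hcurv - 1 / 4 * heq - p.1 / 4 * hcyc

/-- **compatibility of the augmentation system.** For a smooth symmetric
positive-definite determinant-one solution `Φ` of the axisymmetric harmonic-map equation
on an open set `U ⊆ ℍ°`, the two right-hand sides of the augmentation system are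
compatible: `∂_z(−(2ρ)⁻¹ + (8ρ)⁻¹Tr(𝒰²−𝒱²)) = ∂_ρ((4ρ)⁻¹Tr(𝒰𝒱))` on `U`.
In particular, if `U` is simply connected then an augmentation `ν` exists, unique up to
an additive constant. -/
theorem stmt17 (U : Set (ℝ × ℝ)) (hUopen : IsOpen U) (hUH : U ⊆ Hplane)
    (Φ : ℝ × ℝ → Mat2) (hΦsmooth : SmoothMatOn Φ U)
    (hΦpos : ∀ p ∈ U, (Φ p).PosDef) (hΦdet : ∀ p ∈ U, (Φ p).det = 1)
    (hΦharm : axiHarmonicOn Φ U) :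
    (∀ p ∈ U,
      pd2 (fun q => -(2 * q.1)⁻¹ +
          (8 * q.1)⁻¹ * (Umat Φ q * Umat Φ q - Vmat Φ q * Vmat Φ q).trace) p =
        pd1 (fun q => (4 * q.1)⁻¹ * (Umat Φ q * Vmat Φ q).trace) p) ∧
    (SimplyConnectedSpace ↥U →
      ∃ ν : ℝ × ℝ → ℝ, IsAugmentationOn Φ ν U ∧
        ∀ ν' : ℝ × ℝ → ℝ, IsAugmentationOn Φ ν' U →
          ∃ c : ℝ, Set.EqOn ν' (fun p => ν p + c) U) := by
  have hP : Set.EqOn (fun q => -(2 * q.1)⁻¹ +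
      (8 * q.1)⁻¹ * (Umat Φ q * Umat Φ q - Vmat Φ q * Vmat Φ q).trace) _ U := fun q hq =>
    (Umat_Vmat_trace_eq hUopen hUH hΦsmooth hΦdet hq).1
  have hQ : Set.EqOn (fun q => (4 * q.1)⁻¹ * (Umat Φ q * Vmat Φ q).trace) _ U := fun q hq =>
    (Umat_Vmat_trace_eq hUopen hUH hΦsmooth hΦdet hq).2
  have hM := hΦsmooth.mcForm hUopen (1, 0)
  have hN := hΦsmooth.mcForm hUopen (0, 1)
  have hcompat : ∀ p ∈ U,
      pd2 (fun q => -(2 * q.1)⁻¹ +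
          (8 * q.1)⁻¹ * (Umat Φ q * Umat Φ q - Vmat Φ q * Vmat Φ q).trace) p =
        pd1 (fun q => (4 * q.1)⁻¹ * (Umat Φ q * Vmat Φ q).trace) p := fun p hp => by
    rw [pd2_congr hUopen hP hp, pd1_congr hUopen hQ hp]
    exact augmentation_compatible hUopen hΦsmooth hΦdet hΦharm hp
  refine ⟨hcompat, fun _ => ?_⟩
  obtain ⟨ν, hν, hν'⟩ := exists_potential_of_pd_eq hUopen
    ((((contDiffOn_fst.div_const 8).mul ((hM.mul hM).trace.sub (hN.mul hN).trace)).sub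
      ((contDiffOn_const.mul contDiffOn_fst).inv fun q hq =>
        mul_ne_zero four_ne_zero (hUH hq).ne')).congr hP)
    (((contDiffOn_fst.div_const 4).mul (hM.mul hN).trace).congr hQ) hcompat
  refine ⟨ν, ⟨hν, fun p hp => (hν' p hp).symm⟩, fun ν₂ ⟨hν₂, hν₂'⟩ => ?_⟩
  exact exists_eq_add_const_of_pd_eq hUopen
    (isPreconnected_iff_preconnectedSpace.2 inferInstance)
    (hν₂.differentiableOn (by simp)) (hν.differentiableOn (by simp))
    (fun p hp => (hν₂' p hp).2.trans (hν' p hp).1.symm)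
    (fun p hp => (hν₂' p hp).1.trans (hν' p hp).2.symm)
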